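/- Let (z₁,ζ₁), …, (zₙ,ζₙ) ∈ D², let sᵢ = zᵢ + ζᵢ and pᵢ = zᵢζᵢ (so (sᵢ,pᵢ) ∈ G), and let w₁, …, wₙ ∈ ℂ. There exists an analytic function g : G → ℂ with |g(s,p)| ≤ 1 for all (s,p) ∈ G satisfying g(sᵢ,pᵢ) = wᵢ for i = 1, …, n, if and only if there exists an analytic function f : D² → ℂ with |f(z,ζ)| ≤ 1 for all (z,ζ) ∈ D² satisfying f(zᵢ,ζᵢ) = wᵢ and f(ζᵢ,zᵢ) = wᵢ for i = 1, …, n. -/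

import Mathlib

noncomputable section

/-- The open bidisk `𝔻² = {(z,ζ) : |z| < 1, |ζ| < 1}`. -/
def bidisk : Set (ℂ × ℂ) := {w : ℂ × ℂ | ‖w.1‖ < 1 ∧ ‖w.2‖ < 1}

/-- The symmetrized bidisk `𝔾`, the image of the bidisk under `(z,ζ) ↦ (z+ζ, zζ)`. -/
def symBidisk : Set (ℂ × ℂ) := (fun w : ℂ × ℂ => (w.1 + w.2, w.1 * w.2)) '' bidisk

theorem mem_bidisk_mk {a b : ℂ} (ha : ‖a‖ < 1) (hb : ‖b‖ < 1) : (a, b) ∈ bidisk := by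
  unfold bidisk
  exact ⟨ha, hb⟩

theorem mem_symBidisk_mk {x : ℂ × ℂ} (hx : x ∈ bidisk) : (x.1 + x.2, x.1 * x.2) ∈ symBidisk := by
  unfold symBidisk
  exact ⟨x, hx, rfl⟩

theorem exists_of_mem_symBidisk {q : ℂ × ℂ} (hq : q ∈ symBidisk) :
    ∃ u v : ℂ, ‖u‖ < 1 ∧ ‖v‖ < 1 ∧ q = (u + v, u * v) := by
  unfold symBidisk bidisk at hq
  obtain ⟨⟨u, v⟩, ⟨hu, hv⟩, rfl⟩ := hq
  exact ⟨u, v, hu, hv, rfl⟩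

/-- Iterated integral over the square `[0,2π]²` as a continuous linear functional. -/
def sqInt : C(Set.Icc (0:ℝ) (2 * Real.pi) × Set.Icc (0:ℝ) (2 * Real.pi), ℂ) →L[ℂ] ℂ :=
  have h0 : (0:ℝ) ≤ 2 * Real.pi := by positivity
  LinearMap.mkContinuous
    { toFun := fun φ => ∫ θ in (0:ℝ)..(2 * Real.pi), ∫ η in (0:ℝ)..(2 * Real.pi),
        φ (Set.projIcc 0 (2 * Real.pi) h0 θ, Set.projIcc 0 (2 * Real.pi) h0 η)
      map_add' := by
        intro φ ψ
        have hc : ∀ φ : C(Set.Icc (0:ℝ) (2 * Real.pi) × Set.Icc (0:ℝ) (2 * Real.pi), ℂ),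
            Continuous (fun q : ℝ × ℝ =>
              φ (Set.projIcc 0 (2 * Real.pi) h0 q.1, Set.projIcc 0 (2 * Real.pi) h0 q.2)) := by
          intro φ
          exact φ.continuous.comp ((continuous_projIcc.comp continuous_fst).prodMk
            (continuous_projIcc.comp continuous_snd))
        have hi : ∀ φ : C(Set.Icc (0:ℝ) (2 * Real.pi) × Set.Icc (0:ℝ) (2 * Real.pi), ℂ), ∀ θ,
            Continuous (fun η : ℝ =>
              φ (Set.projIcc 0 (2 * Real.pi) h0 θ, Set.projIcc 0 (2 * Real.pi) h0 η)) := by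
          intro φ θ
          exact (hc φ).comp (Continuous.prodMk_right θ)
        have ho : ∀ φ : C(Set.Icc (0:ℝ) (2 * Real.pi) × Set.Icc (0:ℝ) (2 * Real.pi), ℂ),
            Continuous (fun θ : ℝ => ∫ η in (0:ℝ)..(2 * Real.pi),
              φ (Set.projIcc 0 (2 * Real.pi) h0 θ, Set.projIcc 0 (2 * Real.pi) h0 η)) := by
          intro φ
          exact intervalIntegral.continuous_parametric_intervalIntegral_of_continuous' (hc φ) _ _
        rw [← intervalIntegral.integral_add ((ho φ).intervalIntegrable _ _)
          ((ho ψ).intervalIntegrable _ _)]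
        congr 1
        funext θ
        rw [← intervalIntegral.integral_add ((hi φ θ).intervalIntegrable _ _)
          ((hi ψ θ).intervalIntegrable _ _)]
        rfl
      map_smul' := by
        intro c φ
        simp only [ContinuousMap.smul_apply, intervalIntegral.integral_smul, RingHom.id_apply] }
    ((2 * Real.pi) * (2 * Real.pi)) (by
      intro φ
      have h1 : ∀ θ : ℝ, ‖∫ η in (0:ℝ)..(2 * Real.pi),
              φ (Set.projIcc 0 (2 * Real.pi) h0 θ, Set.projIcc 0 (2 * Real.pi) h0 η)‖
              ≤ ‖φ‖ * |2 * Real.pi - 0| := fun θ =>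
        intervalIntegral.norm_integral_le_of_norm_le_const fun η _ => φ.norm_coe_le_norm _
      have h2 := intervalIntegral.norm_integral_le_of_norm_le_const (a := 0) (b := 2 * Real.pi)
        (fun θ _ => h1 θ)
      rw [sub_zero, abs_of_nonneg h0] at h2
      refine h2.trans (le_of_eq ?_)
      ring)

/-- The kernel integral. -/
def kerInt (f : ℂ × ℂ → ℂ) (r : ℝ) (s p : ℂ) : ℂ :=
  ∮ x in C(0, r), ∮ y in C(0, r),
    f (x, y) * (x * y - s * (x + y) / 2 + p) * (x ^ 2 - s * x + p)⁻¹ * (y ^ 2 - s * y + p)⁻¹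

theorem ring_inverse_apply {X : Type*} [TopologicalSpace X] (a : C(X, ℂ)) (ha : ∀ x, a x ≠ 0)
    (x : X) : (Ring.inverse a) x = (a x)⁻¹ := by
  have hu : IsUnit a := (ContinuousMap.isUnit_iff_forall_ne_zero a).2 ha
  have h := congrArg (fun φ : C(X, ℂ) => φ x) (Ring.inverse_mul_cancel a hu)
  simp only [ContinuousMap.mul_apply, ContinuousMap.one_apply] at h
  exact eq_inv_of_mul_eq_one_left h

theorem kerInt_analyticAt (f : ℂ × ℂ → ℂ) (hf : ContinuousOn f bidisk) (r : ℝ) (hr0 : 0 < r)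
    (hr1 : r < 1) (q : ℂ × ℂ)
    (hq : ∀ᶠ q' : ℂ × ℂ in nhds q, ∀ x : ℂ, ‖x‖ = r → x ^ 2 - q'.1 * x + q'.2 ≠ 0) :
    AnalyticAt ℂ (fun q : ℂ × ℂ => kerInt f r q.1 q.2) q := by
  let I := Set.Icc (0:ℝ) (2 * Real.pi)
  let cx : C(I × I, ℂ) := ⟨fun t => circleMap 0 r t.1, by fun_prop⟩
  let cy : C(I × I, ℂ) := ⟨fun t => circleMap 0 r t.2, by fun_prop⟩
  have hn : ∀ t : ℝ, ‖circleMap 0 r t‖ = r := by intro t; simp [hr0.le]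
  let H : C(I × I, ℂ) := ⟨fun t => f (circleMap 0 r t.1, circleMap 0 r t.2) *
      (circleMap 0 r t.1 * Complex.I) * (circleMap 0 r t.2 * Complex.I), by
    have : Continuous fun t : I × I => f (circleMap 0 r t.1, circleMap 0 r t.2) := by
      refine hf.comp_continuous (by fun_prop) ?_
      intro t
      exact mem_bidisk_mk (by rw [hn]; exact hr1) (by rw [hn]; exact hr1)
    have h1 : Continuous fun t : I × I => circleMap 0 r t.1 * Complex.I := by fun_prop
    have h2 : Continuous fun t : I × I => circleMap 0 r t.2 * Complex.I := by fun_prop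
    exact (this.mul h1).mul h2⟩
  let Px : ℂ × ℂ → C(I × I, ℂ) := fun q => cx ^ 2 - q.1 • cx + q.2 • (1 : C(I × I, ℂ))
  let Py : ℂ × ℂ → C(I × I, ℂ) := fun q => cy ^ 2 - q.1 • cy + q.2 • (1 : C(I × I, ℂ))
  let N : ℂ × ℂ → C(I × I, ℂ) := fun q =>
    cx * cy - q.1 • ((2⁻¹ : ℂ) • (cx + cy)) + q.2 • (1 : C(I × I, ℂ))
  have hPx : AnalyticAt ℂ Px q :=
    ((analyticAt_const.sub (analyticAt_fst.smul analyticAt_const)).add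
      (analyticAt_snd.smul analyticAt_const))
  have hPy : AnalyticAt ℂ Py q :=
    ((analyticAt_const.sub (analyticAt_fst.smul analyticAt_const)).add
      (analyticAt_snd.smul analyticAt_const))
  have hN : AnalyticAt ℂ N q :=
    ((analyticAt_const.sub (analyticAt_fst.smul analyticAt_const)).add
      (analyticAt_snd.smul analyticAt_const))
  have hinv : ∀ P : ℂ × ℂ → C(I × I, ℂ), AnalyticAt ℂ P q → (∀ t, P q t ≠ 0) →
      AnalyticAt ℂ (fun q => Ring.inverse (P q)) q := by
    intro P hP h0
    obtain ⟨u, hu⟩ := (ContinuousMap.isUnit_iff_forall_ne_zero (P q)).2 h0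
    have h1 : AnalyticAt ℂ (Ring.inverse : C(I × I, ℂ) → C(I × I, ℂ)) (P q) := by
      rw [← hu]; exact analyticAt_inverse u
    exact h1.comp hP
  have hPx0 : ∀ q' : ℂ × ℂ, (∀ x : ℂ, ‖x‖ = r → x ^ 2 - q'.1 * x + q'.2 ≠ 0) →
      ∀ t, Px q' t ≠ 0 := by
    intro q' h t
    simpa [Px, cx] using h _ (hn t.1)
  have hPy0 : ∀ q' : ℂ × ℂ, (∀ x : ℂ, ‖x‖ = r → x ^ 2 - q'.1 * x + q'.2 ≠ 0) →
      ∀ t, Py q' t ≠ 0 := by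
    intro q' h t
    simpa [Py, cy] using h _ (hn t.2)
  have hmain : AnalyticAt ℂ (fun q => sqInt (H * N q * Ring.inverse (Px q) *
      Ring.inverse (Py q))) q :=
    (sqInt.analyticAt _).comp ((((analyticAt_const.mul hN).mul
      (hinv Px hPx (hPx0 q hq.self_of_nhds)))).mul (hinv Py hPy (hPy0 q hq.self_of_nhds)))
  refine hmain.congr ?_
  filter_upwards [hq] with q' hq'
  have h0 : (0:ℝ) ≤ 2 * Real.pi := by positivity
  change (∫ θ in (0:ℝ)..(2 * Real.pi), ∫ η in (0:ℝ)..(2 * Real.pi), _) = _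
  unfold kerInt circleIntegral
  refine intervalIntegral.integral_congr ?_
  intro θ hθ
  rw [Set.uIcc_of_le h0] at hθ
  dsimp only
  rw [← intervalIntegral.integral_smul]
  refine intervalIntegral.integral_congr ?_
  intro η hη
  rw [Set.uIcc_of_le h0] at hη
  dsimp only
  rw [Set.projIcc_of_mem h0 hθ, Set.projIcc_of_mem h0 hη]
  rw [ContinuousMap.mul_apply, ContinuousMap.mul_apply, ContinuousMap.mul_apply,
    ring_inverse_apply _ (hPx0 q' hq'), ring_inverse_apply _ (hPy0 q' hq')]
  simp only [H, N, Px, Py, cx, cy, deriv_circleMap, smul_eq_mul, ContinuousMap.coe_mk,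
    ContinuousMap.add_apply, ContinuousMap.sub_apply, ContinuousMap.smul_apply,
    ContinuousMap.mul_apply, ContinuousMap.pow_apply, ContinuousMap.one_apply, mul_one]
  ring

theorem kerInt_eq (f : ℂ × ℂ → ℂ) (hf : DifferentiableOn ℂ f bidisk) (r : ℝ) (hr0 : 0 < r)
    (hr1 : r < 1) (z ζ : ℂ) (hz : ‖z‖ < r) (hζ : ‖ζ‖ < r) :
    kerInt f r (z + ζ) (z * ζ) =
      (2 * Real.pi * Complex.I) ^ 2 * ((f (z, ζ) + f (ζ, z)) / 2) := by
  have hdy : ∀ x : ℂ, ‖x‖ < 1 →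
      DifferentiableOn ℂ (fun y => f (x, y)) (Metric.closedBall 0 r) := by
    intro x hx
    refine hf.comp (f := fun y => (x, y)) (by fun_prop) ?_
    intro y hy
    exact mem_bidisk_mk hx ((mem_closedBall_zero_iff.1 hy).trans_lt hr1)
  have hdx : ∀ y : ℂ, ‖y‖ < 1 →
      DifferentiableOn ℂ (fun x => f (x, y)) (Metric.closedBall 0 r) := by
    intro x hx
    refine hf.comp (f := fun y => (y, x)) (by fun_prop) ?_
    intro y hy
    exact mem_bidisk_mk ((mem_closedBall_zero_iff.1 hy).trans_lt hr1) hx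
  have cauchy : ∀ F : ℂ → ℂ, DifferentiableOn ℂ F (Metric.closedBall 0 r) → ∀ a : ℂ, ‖a‖ < r →
      CircleIntegrable (fun x => (x - a)⁻¹ * F x) 0 r ∧
      ∮ x in C(0, r), (x - a)⁻¹ * F x = (2 * Real.pi * Complex.I) * F a := by
    intro F hF a ha
    constructor
    · apply ContinuousOn.circleIntegrable hr0.le
      refine ContinuousOn.mul (ContinuousOn.inv₀ (by fun_prop) ?_)
        (hF.continuousOn.mono Metric.sphere_subset_closedBall)
      intro x hx h
      rw [mem_sphere_zero_iff_norm] at hx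
      rw [sub_eq_zero.1 h] at hx
      linarith
    · have := hF.circleIntegral_sub_inv_smul (mem_ball_zero_iff.2 ha)
      simpa using this
  have hin : ∀ x ∈ Metric.sphere (0:ℂ) r, (∮ y in C(0, r),
      f (x, y) * (x * y - (z + ζ) * (x + y) / 2 + z * ζ) * (x ^ 2 - (z + ζ) * x + z * ζ)⁻¹ *
        (y ^ 2 - (z + ζ) * y + z * ζ)⁻¹) =
      (Real.pi * Complex.I) * ((x - ζ)⁻¹ * f (x, z) + (x - z)⁻¹ * f (x, ζ)) := by
    intro x hx
    rw [mem_sphere_zero_iff_norm] at hx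
    have hne : ∀ x a : ℂ, ‖x‖ = r → ‖a‖ < r → x - a ≠ 0 := by
      intro x a hx ha h
      rw [sub_eq_zero.1 h] at hx
      linarith
    obtain ⟨i1, e1⟩ := cauchy _ (hdy x (by linarith)) z hz
    obtain ⟨i2, e2⟩ := cauchy _ (hdy x (by linarith)) ζ hζ
    have hxz := hne x z hx hz
    have hxζ := hne x ζ hx hζ
    have : (∮ y in C(0, r),
      f (x, y) * (x * y - (z + ζ) * (x + y) / 2 + z * ζ) * (x ^ 2 - (z + ζ) * x + z * ζ)⁻¹ *
        (y ^ 2 - (z + ζ) * y + z * ζ)⁻¹) =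
      ∮ y in C(0, r), ((x - ζ)⁻¹ / 2 * ((y - z)⁻¹ * f (x, y)) +
        (x - z)⁻¹ / 2 * ((y - ζ)⁻¹ * f (x, y))) := by
      apply circleIntegral.integral_congr hr0.le
      intro y hy
      rw [mem_sphere_zero_iff_norm] at hy
      have hyz := hne y z hy hz
      have hyζ := hne y ζ hy hζ
      dsimp only
      rw [show x ^ 2 - (z + ζ) * x + z * ζ = (x - z) * (x - ζ) by ring,
        show y ^ 2 - (z + ζ) * y + z * ζ = (y - z) * (y - ζ) by ring]
      field_simp
      ring
    rw [this, circleIntegral.integral_add]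
    · rw [circleIntegral.integral_const_mul, circleIntegral.integral_const_mul, e1, e2]
      ring
    · exact i1.const_fun_smul (a := (x - ζ)⁻¹ / 2)
    · exact i2.const_fun_smul (a := (x - z)⁻¹ / 2)
  unfold kerInt
  rw [circleIntegral.integral_congr hr0.le hin]
  obtain ⟨i1, e1⟩ := cauchy _ (hdx z (by linarith)) ζ hζ
  obtain ⟨i2, e2⟩ := cauchy _ (hdx ζ (by linarith)) z hz
  rw [circleIntegral.integral_const_mul, circleIntegral.integral_add i1 i2, e1, e2]
  ring

theorem exists_roots (s p : ℂ) : ∃ z ζ : ℂ, s = z + ζ ∧ p = z * ζ := by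
  obtain ⟨d, hd⟩ := IsAlgClosed.exists_pow_nat_eq (s ^ 2 - 4 * p) (n := 2) (by norm_num)
  refine ⟨(s + d) / 2, (s - d) / 2, by ring, ?_⟩
  linear_combination (1 / 4) * hd

theorem roots_unique {z ζ a b : ℂ} (h1 : a + b = z + ζ) (h2 : a * b = z * ζ) :
    (a = z ∧ b = ζ) ∨ (a = ζ ∧ b = z) := by
  have h : (a - z) * (a - ζ) = 0 := by linear_combination a * h1 - h2
  rcases mul_eq_zero.1 h with h | h
  · left
    have := sub_eq_zero.1 h
    subst this
    exact ⟨rfl, add_left_cancel h1⟩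
  · right
    have := sub_eq_zero.1 h
    subst this
    exact ⟨rfl, by linear_combination h1⟩

theorem eventually_no_root (z ζ : ℂ) (r : ℝ) (hr0 : 0 < r) (hz : ‖z‖ < r) (hζ : ‖ζ‖ < r) :
    ∀ᶠ q : ℂ × ℂ in nhds (z + ζ, z * ζ), ∀ x : ℂ, r ≤ ‖x‖ → x ^ 2 - q.1 * x + q.2 ≠ 0 := by
  have key : ∀ᶠ q : ℂ × ℂ in nhds (z + ζ, z * ζ), ∀ y ∈ Metric.closedBall (0:ℂ) r⁻¹,
      1 - q.1 * y + q.2 * y ^ 2 ≠ 0 := by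
    apply (isCompact_closedBall (0:ℂ) r⁻¹).eventually_forall_of_forall_eventually
    intro y hy
    rw [mem_closedBall_zero_iff] at hy
    have hc : Continuous fun t : (ℂ × ℂ) × ℂ => 1 - t.1.1 * t.2 + t.1.2 * t.2 ^ 2 := by fun_prop
    have hl : ∀ a : ℂ, ‖a‖ < r → 1 - a * y ≠ 0 := by
      intro a ha h
      have h1 : ‖a * y‖ = 1 := by rw [← sub_eq_zero.1 h]; simp
      rw [norm_mul] at h1
      have : ‖a‖ * ‖y‖ ≤ ‖a‖ * r⁻¹ := by gcongr
      have h3 : ‖a‖ * r⁻¹ < 1 := by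
        rw [← div_eq_mul_inv, div_lt_one hr0]; exact ha
      linarith
    refine hc.continuousAt.eventually_ne ?_
    have := mul_ne_zero (hl z hz) (hl ζ hζ)
    convert this using 1
    ring
  filter_upwards [key] with q hq x hx h
  have hx0 : x ≠ 0 := by
    intro h; rw [h, norm_zero] at hx; linarith
  apply hq x⁻¹
  · rw [mem_closedBall_zero_iff, norm_inv]
    gcongr
  · have : 1 - q.1 * x⁻¹ + q.2 * x⁻¹ ^ 2 = (x ^ 2 - q.1 * x + q.2) * x⁻¹ ^ 2 := by
      field_simp
    rw [this, h, zero_mul]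

theorem nevanlinna_pick_symmetrized_bidisk_iff_bidisk (n : ℕ) (z ζ : Fin n → ℂ)
    (hz : ∀ i, (z i, ζ i) ∈ bidisk) (w : Fin n → ℂ) :
    (∃ g : ℂ × ℂ → ℂ,
        AnalyticOnNhd ℂ g symBidisk ∧ (∀ x ∈ symBidisk, ‖g x‖ ≤ 1) ∧
          ∀ i, g (z i + ζ i, z i * ζ i) = w i) ↔
      ∃ f : ℂ × ℂ → ℂ,
        AnalyticOnNhd ℂ f bidisk ∧ (∀ x ∈ bidisk, ‖f x‖ ≤ 1) ∧
          ∀ i, f (z i, ζ i) = w i ∧ f (ζ i, z i) = w i := by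
  constructor
  · rintro ⟨g, hg, hb, hi⟩
    refine ⟨fun x => g (x.1 + x.2, x.1 * x.2), ?_, ?_, ?_⟩
    · intro x hx
      have h1 : AnalyticAt ℂ (fun x : ℂ × ℂ => (x.1 + x.2, x.1 * x.2)) x :=
        (analyticAt_fst.add analyticAt_snd).prod (analyticAt_fst.mul analyticAt_snd)
      exact (hg _ (mem_symBidisk_mk hx)).comp (f := fun x : ℂ × ℂ => (x.1 + x.2, x.1 * x.2)) h1
    · intro x hx
      exact hb _ (mem_symBidisk_mk hx)
    · intro i
      refine ⟨hi i, ?_⟩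
      simp only
      rw [add_comm, mul_comm]
      exact hi i
  · rintro ⟨f, hf, hb, hi⟩
    choose a b hab1 hab2 using exists_roots
    let g : ℂ × ℂ → ℂ := fun q =>
      (f (a q.1 q.2, b q.1 q.2) + f (b q.1 q.2, a q.1 q.2)) / 2
    have hg : ∀ u v : ℂ, g (u + v, u * v) = (f (u, v) + f (v, u)) / 2 := by
      intro u v
      rcases roots_unique (hab1 (u + v) (u * v)).symm (hab2 (u + v) (u * v)).symm with
        ⟨h1, h2⟩ | ⟨h1, h2⟩
      · simp only [g, h1, h2]
      · simp only [g, h1, h2]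
        rw [add_comm]
    refine ⟨g, ?_, ?_, ?_⟩
    · intro q hq
      obtain ⟨u, v, hu, hv, rfl⟩ := exists_of_mem_symBidisk hq
      obtain ⟨r, hr, hr1⟩ := exists_between (max_lt hu hv)
      have hur : ‖u‖ < r := (le_max_left _ _).trans_lt hr
      have hvr : ‖v‖ < r := (le_max_right _ _).trans_lt hr
      have hr0 : 0 < r := (norm_nonneg u).trans_lt hur
      have hev := eventually_no_root u v r hr0 hur hvr
      have hk := kerInt_analyticAt f hf.continuousOn r hr0 hr1 (u + v, u * v)
        (hev.mono fun q hq x hx => hq x hx.ge)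
      refine ((analyticAt_const (v := ((2 * Real.pi * Complex.I) ^ 2)⁻¹)).mul hk).congr ?_
      filter_upwards [hev] with q hq
      obtain ⟨s, p⟩ := q
      obtain ⟨c, d, rfl, rfl⟩ := exists_roots s p
      have hc : ‖c‖ < r := by
        by_contra h
        exact hq c (not_lt.1 h) (by ring)
      have hd : ‖d‖ < r := by
        by_contra h
        exact hq d (not_lt.1 h) (by ring)
      have h2 : (2 * Real.pi * Complex.I) ^ 2 ≠ 0 := pow_ne_zero _ Complex.two_pi_I_ne_zero
      change _ * kerInt f r (c + d) (c * d) = _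
      rw [hg, kerInt_eq f hf.differentiableOn r hr0 hr1 c d hc hd, inv_mul_cancel_left₀ h2]
    · intro q hq
      obtain ⟨u, v, hu, hv, rfl⟩ := exists_of_mem_symBidisk hq
      rw [hg, norm_div, Complex.norm_ofNat]
      have h1 := hb (u, v) (mem_bidisk_mk hu hv)
      have h2 := hb (v, u) (mem_bidisk_mk hv hu)
      have h3 := norm_add_le (f (u, v)) (f (v, u))
      rw [div_le_one (by norm_num)]
      linarith
    · intro i
      rw [hg, (hi i).1, (hi i).2]
      ring
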